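/- arXiv:1608.04573 — 2 statements merged into one kernel-verified Lean document; each statement's English description precedes it below -/
import Mathlib

section
/- Let n ≥ 1, a = (a₁,…,aₙ) ∈ [1,∞)ⁿ and r > 0, and set λ_r(ξ) := Σ_{k=1}^n (1 + ξ_k²)^{r/(2a_k)}. Then for all ξ ∈ ℝⁿ one has (n+1)^{-r}·(1 + |ξ|_a)^r ≤ λ_r(ξ) ≤ n·(1 + |ξ|_a)^r. In particular λ_r has no zeros and grows polynomially. -/
/-- The anisotropic distance function `|x|_a`: it is `0` at `x = 0`, and for `x ≠ 0` it is
the unique `t > 0` with `x₁²/t^{2a₁} + ⋯ + xₙ²/t^{2aₙ} = 1` (chosen via `Classical.epsilon`). -/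
noncomputable def anisoNorm {n : ℕ} (a : Fin n → ℝ) (x : Fin n → ℝ) : ℝ :=
  if x = 0 then 0
  else Classical.epsilon fun t : ℝ => 0 < t ∧ ∑ i, (x i) ^ 2 / t ^ (2 * a i) = 1

theorem sq_div_rpow_eq {a t : ℝ} (ha : 1 ≤ a) (ht : 0 < t) (x : ℝ) :
    x ^ 2 / t ^ (2 * a) = (|x| ^ (1 / a) / t) ^ (2 * a) := by
  have ha0 : a ≠ 0 := by positivity
  rw [Real.div_rpow (by positivity) ht.le, ← Real.rpow_mul (abs_nonneg x),
    show 1 / a * (2 * a) = 2 by field_simp, Real.rpow_two, sq_abs]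

theorem sq_div_rpow_le {a t : ℝ} (ha : 1 ≤ a) (ht : 0 < t) {x : ℝ} (hx : |x| ^ (1 / a) ≤ t) :
    x ^ 2 / t ^ (2 * a) ≤ |x| ^ (1 / a) / t := by
  rw [sq_div_rpow_eq ha ht]
  exact Real.rpow_le_self_of_le_one (by positivity) ((div_le_one ht).2 hx) (by linarith)

theorem exists_sum_sq_div_rpow_eq_one {n : ℕ} {a : Fin n → ℝ} (ha : ∀ i, 1 ≤ a i)
    {x : Fin n → ℝ} (hx : x ≠ 0) :
    ∃ t : ℝ, 0 < t ∧ ∑ i, (x i) ^ 2 / t ^ (2 * a i) = 1 := by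
  obtain ⟨j, hj⟩ := Function.ne_iff.1 hx
  have hj' : 0 < |x j| := abs_pos.2 hj
  set p : Fin n → ℝ := fun i => |x i| ^ (1 / a i) with hp
  have hp0 : ∀ i, 0 ≤ p i := fun i => by positivity
  have hpj : 0 < p j := by positivity
  have hle : ∀ i, p i ≤ ∑ k, p k := fun i =>
    Finset.single_le_sum (fun k _ => hp0 k) (Finset.mem_univ i)
  have hu : 0 < ∑ k, p k := hpj.trans_le (hle j)
  have hcont : ContinuousOn (fun t : ℝ => ∑ i, (x i) ^ 2 / t ^ (2 * a i))
      (Set.Icc (p j) (∑ k, p k)) := by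
    refine continuousOn_finsetSum _ fun i _ => continuousOn_const.div ?_ ?_
    · exact continuousOn_id.rpow_const fun t ht => Or.inl (hpj.trans_le ht.1).ne'
    · exact fun t ht => (Real.rpow_pos_of_pos (hpj.trans_le ht.1) _).ne'
  have hlow : ∑ i, (x i) ^ 2 / (∑ k, p k) ^ (2 * a i) ≤ 1 := by
    calc _ ≤ ∑ i, p i / ∑ k, p k :=
          Finset.sum_le_sum fun i _ => sq_div_rpow_le (ha i) hu (hle i)
      _ = 1 := by rw [← Finset.sum_div, div_self hu.ne']
  have hhigh : 1 ≤ ∑ i, (x i) ^ 2 / (p j) ^ (2 * a i) := by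
    have h1 : (x j) ^ 2 / (p j) ^ (2 * a j) = 1 := by
      rw [sq_div_rpow_eq (ha j) hpj, div_self hpj.ne', Real.one_rpow]
    rw [← h1]
    exact Finset.single_le_sum (f := fun i => (x i) ^ 2 / (p j) ^ (2 * a i))
      (fun i _ => by positivity) (Finset.mem_univ j)
  obtain ⟨t, ht, hft⟩ := intermediate_value_Icc' (hle j) hcont ⟨hlow, hhigh⟩
  exact ⟨t, hpj.trans_le ht.1, hft⟩

theorem anisoNorm_spec {n : ℕ} {a : Fin n → ℝ} (ha : ∀ i, 1 ≤ a i)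
    {x : Fin n → ℝ} (hx : x ≠ 0) :
    0 < anisoNorm a x ∧ ∑ i, (x i) ^ 2 / (anisoNorm a x) ^ (2 * a i) = 1 := by
  rw [anisoNorm, if_neg hx]
  exact Classical.epsilon_spec (exists_sum_sq_div_rpow_eq_one ha hx)

theorem anisoNorm_nonneg {n : ℕ} {a : Fin n → ℝ} (ha : ∀ i, 1 ≤ a i) (x : Fin n → ℝ) :
    0 ≤ anisoNorm a x := by
  by_cases hx : x = 0
  · simp [anisoNorm, hx]
  · exact (anisoNorm_spec ha hx).1.le

theorem sq_le_anisoNorm_rpow {n : ℕ} {a : Fin n → ℝ} (ha : ∀ i, 1 ≤ a i) (x : Fin n → ℝ)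
    (i : Fin n) : (x i) ^ 2 ≤ anisoNorm a x ^ (2 * a i) := by
  by_cases hx : x = 0
  · have := Real.rpow_nonneg (anisoNorm_nonneg ha x) (2 * a i)
    simpa [hx] using this
  · obtain ⟨h0, h1⟩ := anisoNorm_spec ha hx
    rw [← div_le_one (by positivity), ← h1]
    exact Finset.single_le_sum (f := fun i => (x i) ^ 2 / (anisoNorm a x) ^ (2 * a i))
      (fun i _ => by positivity) (Finset.mem_univ i)

theorem abs_rpow_le_anisoNorm {n : ℕ} {a : Fin n → ℝ} (ha : ∀ i, 1 ≤ a i) (x : Fin n → ℝ)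
    (i : Fin n) : |x i| ^ (1 / a i) ≤ anisoNorm a x := by
  have hs := anisoNorm_nonneg ha x
  have hai : 0 < a i := by linarith [ha i]
  have h := sq_le_anisoNorm_rpow ha x i
  rw [one_div, Real.rpow_inv_le_iff_of_pos (abs_nonneg _) hs hai]
  refine abs_le_of_sq_le_sq (h.trans_eq ?_) (by positivity)
  rw [mul_comm, Real.rpow_mul hs, Real.rpow_two]

theorem anisoNorm_le_sum {n : ℕ} {a : Fin n → ℝ} (ha : ∀ i, 1 ≤ a i) (x : Fin n → ℝ) :
    anisoNorm a x ≤ ∑ i, |x i| ^ (1 / a i) := by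
  by_cases hx : x = 0
  · rw [anisoNorm, if_pos hx]
    exact Finset.sum_nonneg fun i _ => by positivity
  · obtain ⟨h0, h1⟩ := anisoNorm_spec ha hx
    rw [← one_le_div h0, Finset.sum_div]
    exact h1.symm.trans_le <| Finset.sum_le_sum fun i _ =>
      sq_div_rpow_le (ha i) h0 (abs_rpow_le_anisoNorm ha x i)

theorem abs_rpow_le_one_add_sq_rpow {a : ℝ} (ha : 1 ≤ a) (x : ℝ) :
    |x| ^ (1 / a) ≤ (1 + x ^ 2) ^ (1 / (2 * a)) := by
  have ha0 : a ≠ 0 := by positivity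
  calc |x| ^ (1 / a) = (x ^ 2) ^ (1 / (2 * a)) := by
        rw [← sq_abs x, ← Real.rpow_two, ← Real.rpow_mul (abs_nonneg x)]
        congr 1
        field_simp
    _ ≤ _ := Real.rpow_le_rpow (by positivity) (by linarith) (by positivity)

/-- for `r > 0` the symbol `λ_r(ξ) = Σ_k (1 + ξ_k²)^{r/(2a_k)}` of the lift
operator satisfies `(n+1)^{-r}(1+|ξ|_a)^r ≤ λ_r(ξ) ≤ n(1+|ξ|_a)^r`. -/
theorem statement6 {n : ℕ} (hn : 1 ≤ n) (a : Fin n → ℝ) (ha : ∀ i, 1 ≤ a i)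
    (r : ℝ) (hr : 0 < r) (ξ : Fin n → ℝ) :
    ((n : ℝ) + 1) ^ (-r) * (1 + anisoNorm a ξ) ^ r ≤
        ∑ k, (1 + ξ k ^ 2) ^ (r / (2 * a k)) ∧
      ∑ k, (1 + ξ k ^ 2) ^ (r / (2 * a k)) ≤ (n : ℝ) * (1 + anisoNorm a ξ) ^ r := by
  have hs := anisoNorm_nonneg ha ξ
  have ha0 : ∀ k, 0 < a k := fun k => by linarith [ha k]
  constructor
  · set m : Fin n → ℝ := fun k => (1 + ξ k ^ 2) ^ (1 / (2 * a k)) with hm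
    have : Nonempty (Fin n) := ⟨⟨0, hn⟩⟩
    obtain ⟨j, hj⟩ := Finite.exists_max m
    have hmj : 1 ≤ m j := Real.one_le_rpow (by nlinarith [sq_nonneg (ξ j)])
      (by have := ha0 j; positivity)
    have hsum : anisoNorm a ξ ≤ n * m j := by
      calc anisoNorm a ξ ≤ ∑ i, |ξ i| ^ (1 / a i) := anisoNorm_le_sum ha ξ
        _ ≤ ∑ _i : Fin n, m j :=
          Finset.sum_le_sum fun i _ => (abs_rpow_le_one_add_sq_rpow (ha i) (ξ i)).trans (hj i)
        _ = n * m j := by simp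
    have hbase : 1 + anisoNorm a ξ ≤ ((n : ℝ) + 1) * m j := by linarith
    rw [Real.rpow_neg (by positivity), inv_mul_le_iff₀ (by positivity)]
    calc (1 + anisoNorm a ξ) ^ r ≤ (((n : ℝ) + 1) * m j) ^ r :=
          Real.rpow_le_rpow (by positivity) hbase hr.le
      _ = ((n : ℝ) + 1) ^ r * (1 + ξ j ^ 2) ^ (r / (2 * a j)) := by
          rw [Real.mul_rpow (by positivity) (by positivity), hm, ← Real.rpow_mul (by positivity),
            one_div_mul_eq_div]
      _ ≤ _ := by
          gcongr
          exact Finset.single_le_sum (f := fun k => (1 + ξ k ^ 2) ^ (r / (2 * a k)))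
            (fun k _ => by positivity) (Finset.mem_univ j)
  · calc _ ≤ ∑ _k : Fin n, (1 + anisoNorm a ξ) ^ r := Finset.sum_le_sum fun k _ => ?_
      _ = _ := by simp
    have hk := ha0 k
    have hpow : 1 + ξ k ^ 2 ≤ (1 + anisoNorm a ξ) ^ (2 * a k) := by
      have h := Real.add_rpow_le_rpow_add zero_le_one hs
        (show 1 ≤ 2 * a k by linarith [ha k])
      rw [Real.one_rpow] at h
      linarith [sq_le_anisoNorm_rpow ha ξ k]
    calc (1 + ξ k ^ 2) ^ (r / (2 * a k))
        ≤ ((1 + anisoNorm a ξ) ^ (2 * a k)) ^ (r / (2 * a k)) :=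
          Real.rpow_le_rpow (by positivity) hpow (by positivity)
      _ = (1 + anisoNorm a ξ) ^ r := by
          rw [← Real.rpow_mul (by positivity), mul_div_cancel₀ _ (by positivity)]
end

section
/- Let σ : ℝⁿ → ℝⁿ be a bounded diffeomorphism with inverse τ := σ⁻¹. Then the map ψ ↦ (ψ∘τ)·|det Jτ| is a well-defined continuous linear operator from the Schwartz space 𝒮(ℝⁿ) to itself. -/
/-- The partial derivative `∂_i f` of a function on `ℝⁿ`. -/
noncomputable def pd {n : ℕ} {E : Type*} [NormedAddCommGroup E] [NormedSpace ℝ E]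
    (i : Fin n) (f : (Fin n → ℝ) → E) : (Fin n → ℝ) → E :=
  fun x => fderiv ℝ f x (Pi.single i 1)

/-- The multi-index partial derivative `∂^α f = ∂₁^{α₁} ⋯ ∂ₙ^{αₙ} f`. -/
noncomputable def mderiv {n : ℕ} {E : Type*} [NormedAddCommGroup E] [NormedSpace ℝ E]
    (α : Fin n → ℕ) (f : (Fin n → ℝ) → E) : (Fin n → ℝ) → E :=
  (List.finRange n).foldr (fun i g => (pd i)^[α i] g) f

/-- The Jacobian matrix `Jσ(x) = (∂_k σ_j(x))_{j,k}` of a map `σ : ℝⁿ → ℝⁿ`. -/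
noncomputable def jacobian {n : ℕ} (σ : (Fin n → ℝ) → (Fin n → ℝ)) (x : Fin n → ℝ) :
    Matrix (Fin n) (Fin n) ℝ :=
  Matrix.of fun j k => pd k (fun y => σ y j) x

/-- `σ` is a bounded diffeomorphism with inverse `τ`: both are `C^∞` mutually inverse
bijections of `ℝⁿ`, and all their partial derivatives of order `≥ 1` are bounded. -/
def IsBoundedDiffeo {n : ℕ} (σ τ : (Fin n → ℝ) → (Fin n → ℝ)) : Prop :=
  Function.LeftInverse τ σ ∧ Function.RightInverse τ σ ∧
    ContDiff ℝ (⊤ : ℕ∞) σ ∧ ContDiff ℝ (⊤ : ℕ∞) τ ∧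
    (∀ (j : Fin n) (α : Fin n → ℕ), 1 ≤ ∑ i, α i →
      ∃ M : ℝ, ∀ x, |mderiv α (fun z => σ z j) x| ≤ M) ∧
    (∀ (j : Fin n) (α : Fin n → ℕ), 1 ≤ ∑ i, α i →
      ∃ M : ℝ, ∀ y, |mderiv α (fun z => τ z j) y| ≤ M)

/-- The partial derivative of a smooth function is smooth. -/
theorem ContDiff.partialDeriv {n : ℕ} {E : Type*} [NormedAddCommGroup E] [NormedSpace ℝ E]
    {f : (Fin n → ℝ) → E} (hf : ContDiff ℝ (⊤ : ℕ∞) f) (i : Fin n) :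
    ContDiff ℝ (⊤ : ℕ∞) (pd i f) :=
  (hf.fderiv_right (m := (⊤ : ℕ∞)) (by simp)).clm_apply contDiff_const

/-- Partial derivatives of smooth functions commute. -/
theorem pd_comm {n : ℕ} {E : Type*} [NormedAddCommGroup E] [NormedSpace ℝ E]
    {f : (Fin n → ℝ) → E} (hf : ContDiff ℝ (⊤ : ℕ∞) f) (i j : Fin n) :
    pd i (pd j f) = pd j (pd i f) := by
  have hd : Differentiable ℝ (fderiv ℝ f) :=
    (hf.fderiv_right (m := (⊤ : ℕ∞)) (by simp)).differentiable (by simp)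
  have key (i j : Fin n) (x : Fin n → ℝ) :
      pd i (pd j f) x = fderiv ℝ (fderiv ℝ f) x (Pi.single i 1) (Pi.single j 1) := by
    have := fderiv_clm_apply (hd x) (differentiableAt_const (Pi.single j (1 : ℝ) : Fin n → ℝ))
    have h2 : pd i (pd j f) x =
      fderiv ℝ (fun y => fderiv ℝ f y (Pi.single j 1)) x (Pi.single i 1) := rfl
    rw [h2, this]
    simp
  funext x
  rw [key, key]
  exact (hf.contDiffAt.isSymmSndFDerivAt
    (by simpa using WithTop.coe_le_coe.2 (le_top (a := (2 : ℕ∞))))) _ _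

/-- Iterated partial derivatives of a smooth function are smooth. -/
theorem ContDiff.partialDeriv_iterate {n : ℕ} {E : Type*} [NormedAddCommGroup E] [NormedSpace ℝ E]
    {f : (Fin n → ℝ) → E} (hf : ContDiff ℝ (⊤ : ℕ∞) f) (i : Fin n) (k : ℕ) :
    ContDiff ℝ (⊤ : ℕ∞) ((pd i)^[k] f) := by
  induction k with
  | zero => exact hf
  | succ k ih =>
    rw [Function.iterate_succ_apply']
    exact ih.partialDeriv i

/-- Iterated partial derivatives of a smooth function commute with a partial derivative. -/
theorem pd_iterate_comm {n : ℕ} {E : Type*} [NormedAddCommGroup E] [NormedSpace ℝ E]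
    {f : (Fin n → ℝ) → E} (hf : ContDiff ℝ (⊤ : ℕ∞) f) (i j : Fin n) (k : ℕ) :
    (pd j)^[k] (pd i f) = pd i ((pd j)^[k] f) := by
  induction k with
  | zero => rfl
  | succ k ih =>
    rw [Function.iterate_succ_apply', Function.iterate_succ_apply', ih,
      pd_comm (hf.partialDeriv_iterate j k)]

/-- The partial derivatives along a list of coordinates of a smooth function are smooth. -/
theorem ContDiff.foldr_partialDeriv {n : ℕ} {E : Type*} [NormedAddCommGroup E] [NormedSpace ℝ E]
    {f : (Fin n → ℝ) → E} (hf : ContDiff ℝ (⊤ : ℕ∞) f) (α : Fin n → ℕ) (l : List (Fin n)) :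
    ContDiff ℝ (⊤ : ℕ∞) (l.foldr (fun i g => (pd i)^[α i] g) f) := by
  induction l with
  | nil => exact hf
  | cons j l ih => exact ih.partialDeriv_iterate j (α j)

/-- The partial derivatives along a list of coordinates commute with a partial derivative. -/
theorem foldr_pd_comm {n : ℕ} {E : Type*} [NormedAddCommGroup E] [NormedSpace ℝ E]
    {f : (Fin n → ℝ) → E} (hf : ContDiff ℝ (⊤ : ℕ∞) f) (i : Fin n) (α : Fin n → ℕ)
    (l : List (Fin n)) :
    l.foldr (fun i g => (pd i)^[α i] g) (pd i f) =
      pd i (l.foldr (fun i g => (pd i)^[α i] g) f) := by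
  induction l with
  | nil => rfl
  | cons j l ih =>
    rw [List.foldr_cons, ih, pd_iterate_comm (hf.foldr_partialDeriv α l), List.foldr_cons]

/-- `∂^α ∂_i f = ∂^(α + e_i) f` for smooth `f`. -/
theorem mderiv_pd {n : ℕ} {E : Type*} [NormedAddCommGroup E] [NormedSpace ℝ E]
    {f : (Fin n → ℝ) → E} (hf : ContDiff ℝ (⊤ : ℕ∞) f) (i : Fin n) (α : Fin n → ℕ) :
    mderiv α (pd i f) = mderiv (α + Pi.single i 1) f := by
  have hnot (l : List (Fin n)) (hi : i ∉ l) :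
      l.foldr (fun j g => (pd j)^[(α + Pi.single i 1 : Fin n → ℕ) j] g) f =
        l.foldr (fun j g => (pd j)^[α j] g) f := by
    induction l with
    | nil => rfl
    | cons j l ih =>
      have hj : j ≠ i := fun h => hi (by simp [h])
      rw [List.foldr_cons, List.foldr_cons, ih (fun h => hi (by simp [h]))]
      simp [hj]
  have hmem (l : List (Fin n)) (hl : l.Nodup) (hi : i ∈ l) :
      l.foldr (fun j g => (pd j)^[α j] g) (pd i f) =
        l.foldr (fun j g => (pd j)^[(α + Pi.single i 1 : Fin n → ℕ) j] g) f := by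
    induction l with
    | nil => simp at hi
    | cons j l ih =>
      rw [List.nodup_cons] at hl
      rw [List.foldr_cons, List.foldr_cons]
      by_cases hj : j = i
      · subst hj
        rw [hnot l hl.1, foldr_pd_comm hf]
        simp [Function.iterate_succ_apply]
      · rw [ih hl.2 (by simpa [Ne.symm hj] using hi)]
        simp [hj]
  exact hmem _ (List.nodup_finRange n) (List.mem_finRange i)

/-- The Fréchet derivative expressed through the partial derivatives. -/
theorem fderiv_eq_sum_pd {n : ℕ} (f : (Fin n → ℝ) → ℝ) :
    fderiv ℝ f = fun x => ∑ i, ContinuousLinearMap.toSpanSingleton ℝ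
      (ContinuousLinearMap.proj i : (Fin n → ℝ) →L[ℝ] ℝ) (pd i f x) := by
  funext x
  ext v
  have hv : v = ∑ i, v i • (Pi.single i (1 : ℝ) : Fin n → ℝ) := by
    rw [pi_eq_sum_univ' v]
    simp [Pi.single_apply, Finset.sum_apply]
  conv_lhs => rw [hv]
  simp [sum_apply, pd, mul_comm]

/-- If all the partial derivatives of a smooth function are bounded, so are its iterated
Fréchet derivatives. -/
theorem exists_norm_iteratedFDeriv_le_of_mderiv {n : ℕ} (k : ℕ) :
    ∀ f : (Fin n → ℝ) → ℝ, ContDiff ℝ (⊤ : ℕ∞) f →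
      (∀ α, ∃ M : ℝ, ∀ x, |mderiv α f x| ≤ M) →
      ∃ C : ℝ, ∀ x, ‖iteratedFDeriv ℝ k f x‖ ≤ C := by
  induction k with
  | zero =>
    intro f _ hb
    obtain ⟨M, hM⟩ := hb 0
    have h0 : mderiv 0 f = f := by
      have (l : List (Fin n)) :
          l.foldr (fun i g => (pd i)^[(0 : Fin n → ℕ) i] g) f = f := by
        induction l with
        | nil => rfl
        | cons j l ih => rw [List.foldr_cons, ih]; rfl
      exact this _
    exact ⟨M, fun x => by simpa [h0] using hM x⟩
  | succ k ih =>
    intro f hf hb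
    have hi (i : Fin n) : ∃ C : ℝ, ∀ x, ‖iteratedFDeriv ℝ k (pd i f) x‖ ≤ C :=
      ih _ (hf.partialDeriv i) fun α => by rw [mderiv_pd hf]; exact hb _
    choose C hC using hi
    refine ⟨∑ i, ‖ContinuousLinearMap.toSpanSingleton ℝ
      (ContinuousLinearMap.proj i : (Fin n → ℝ) →L[ℝ] ℝ)‖ * C i, fun x => ?_⟩
    rw [← norm_iteratedFDeriv_fderiv, fderiv_eq_sum_pd]
    have hs (i : Fin n) : ContDiff ℝ k (pd i f) := (hf.partialDeriv i).of_le (mod_cast le_top)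
    rw [iteratedFDeriv_fun_sum_apply (f := fun i y => ContinuousLinearMap.toSpanSingleton ℝ
      (ContinuousLinearMap.proj i : (Fin n → ℝ) →L[ℝ] ℝ) (pd i f y)) fun i _ =>
      ((ContinuousLinearMap.contDiff _).comp (hs i)).contDiffAt]
    refine (norm_sum_le _ _).trans (Finset.sum_le_sum fun i _ => ?_)
    refine (ContinuousLinearMap.norm_iteratedFDeriv_comp_left _
      (hs i).contDiffAt le_rfl).trans ?_
    gcongr
    exact hC i x

/-- A smooth function all of whose partial derivatives are bounded has temperate growth. -/
theorem hasTemperateGrowth_of_mderiv {n : ℕ} {f : (Fin n → ℝ) → ℝ}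
    (hf : ContDiff ℝ (⊤ : ℕ∞) f) (hb : ∀ α, ∃ M : ℝ, ∀ x, |mderiv α f x| ≤ M) :
    f.HasTemperateGrowth := by
  refine ⟨hf, fun k => ?_⟩
  obtain ⟨C, hC⟩ := exists_norm_iteratedFDeriv_le_of_mderiv k f hf hb
  exact ⟨0, C, fun x => by simpa using hC x⟩

/-- The partial derivatives of a smooth function have temperate growth if all its partial
derivatives of order at least one are bounded. -/
theorem hasTemperateGrowth_pd_of_mderiv {n : ℕ} {f : (Fin n → ℝ) → ℝ}
    (hf : ContDiff ℝ (⊤ : ℕ∞) f)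
    (hb : ∀ α : Fin n → ℕ, 1 ≤ ∑ i, α i → ∃ M : ℝ, ∀ x, |mderiv α f x| ≤ M) (i : Fin n) :
    (pd i f).HasTemperateGrowth :=
  hasTemperateGrowth_of_mderiv (hf.partialDeriv i) fun α => by
    rw [mderiv_pd hf]
    exact hb _ (by simp [Finset.sum_add_distrib])

/-- A smooth function whose partial derivatives of order at least one are bounded has
temperate growth. -/
theorem hasTemperateGrowth_of_mderiv_of_one_le {n : ℕ} {f : (Fin n → ℝ) → ℝ}
    (hf : ContDiff ℝ (⊤ : ℕ∞) f)
    (hb : ∀ α : Fin n → ℕ, 1 ≤ ∑ i, α i → ∃ M : ℝ, ∀ x, |mderiv α f x| ≤ M) :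
    f.HasTemperateGrowth := by
  have hi (i : Fin n) : ∃ C : ℝ, ∀ x, ‖iteratedFDeriv ℝ 0 (pd i f) x‖ ≤ C :=
    exists_norm_iteratedFDeriv_le_of_mderiv 0 _ (hf.partialDeriv i) fun α => by
      rw [mderiv_pd hf]
      exact hb _ (by simp [Finset.sum_add_distrib])
  choose C hC using hi
  set D : ℝ := ∑ i, ‖ContinuousLinearMap.toSpanSingleton ℝ
      (ContinuousLinearMap.proj i : (Fin n → ℝ) →L[ℝ] ℝ)‖ * C i
  have hD (x : Fin n → ℝ) : ‖fderiv ℝ f x‖ ≤ D := by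
    rw [fderiv_eq_sum_pd]
    refine (norm_sum_le _ _).trans (Finset.sum_le_sum fun i _ => ?_)
    refine (ContinuousLinearMap.le_opNorm _ _).trans ?_
    gcongr
    simpa using hC i x
  have hD0 : 0 ≤ D := (norm_nonneg _).trans (hD 0)
  refine .of_fderiv (k := 1) (C := |f 0| + D) ?_ (hf.differentiable (by simp)) fun x => ?_
  · rw [fderiv_eq_sum_pd]
    exact .sum fun i _ => (ContinuousLinearMap.hasTemperateGrowth _).comp
      (hasTemperateGrowth_pd_of_mderiv hf hb i)
  · have h1 := Convex.norm_image_sub_le_of_norm_fderiv_le (s := Set.univ) (x := 0) (y := x)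
      (fun y _ => hf.differentiable (by simp) y) (fun y _ => hD y) convex_univ trivial trivial
    rw [sub_zero] at h1
    have h2 : ‖f x‖ ≤ ‖f 0‖ + ‖f x - f 0‖ := by
      simpa using norm_add_le (f 0) (f x - f 0)
    rw [Real.norm_eq_abs (f 0)] at h2
    nlinarith [norm_nonneg x, abs_nonneg (f 0), mul_nonneg (abs_nonneg (f 0)) (norm_nonneg x)]

/-- A map into `ℝⁿ` has temperate growth if all its components have. -/
theorem Function.HasTemperateGrowth.pi {E ι : Type*} [NormedAddCommGroup E] [NormedSpace ℝ E]
    [Fintype ι] {g : E → ι → ℝ} (hg : ∀ j, (fun x => g x j).HasTemperateGrowth) :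
    g.HasTemperateGrowth := by
  classical
  have : g = fun x => ∑ j, ContinuousLinearMap.single ℝ (fun _ : ι => ℝ) j (g x j) := by
    funext x
    exact (Finset.univ_sum_single (g x)).symm
  rw [this]
  exact .sum fun j _ => (ContinuousLinearMap.hasTemperateGrowth _).comp (hg j)

/-- A finite product of functions of temperate growth has temperate growth. -/
theorem Function.HasTemperateGrowth.prod {E ι : Type*} [NormedAddCommGroup E] [NormedSpace ℝ E]
    {f : ι → E → ℝ} {s : Finset ι} (hf : ∀ i ∈ s, (f i).HasTemperateGrowth) :
    (fun x => ∏ i ∈ s, f i x).HasTemperateGrowth := by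
  classical
  induction s using Finset.induction_on with
  | empty => simp
  | insert a s ha ih =>
    simp only [Finset.prod_insert ha]
    exact (hf a (by simp)).fun_mul (ih fun i hi => hf i (by simp [hi]))

/-- The determinant of a matrix-valued function with entries of temperate growth has
temperate growth. -/
theorem Function.HasTemperateGrowth.matrix_det {E ι : Type*} [NormedAddCommGroup E]
    [NormedSpace ℝ E] [Fintype ι] [DecidableEq ι] {A : E → Matrix ι ι ℝ}
    (hA : ∀ i j, (fun x => A x i j).HasTemperateGrowth) :
    (fun x => (A x).det).HasTemperateGrowth := by
  simp only [Matrix.det_apply']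
  exact .sum fun p _ => (Function.HasTemperateGrowth.const _).fun_mul (.prod fun i _ => hA _ _)

/-- The Jacobian matrix is the matrix of the Fréchet derivative. -/
theorem jacobian_eq_toMatrix' {n : ℕ} {σ : (Fin n → ℝ) → (Fin n → ℝ)} {x : Fin n → ℝ}
    (hσ : DifferentiableAt ℝ σ x) :
    jacobian σ x = LinearMap.toMatrix' (fderiv ℝ σ x : (Fin n → ℝ) →ₗ[ℝ] (Fin n → ℝ)) := by
  ext j k
  rw [LinearMap.toMatrix'_apply]
  simp [jacobian, pd, fderiv_apply hσ]

/-- The Jacobian determinant of a differentiable map with a differentiable left inverse does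
not vanish. -/
theorem det_jacobian_ne_zero {n : ℕ} {σ τ : (Fin n → ℝ) → (Fin n → ℝ)}
    (hσ : Differentiable ℝ σ) (hτ : Differentiable ℝ τ) (h : Function.LeftInverse σ τ)
    (x : Fin n → ℝ) : (jacobian τ x).det ≠ 0 := by
  have hc : (fderiv ℝ σ (τ x)).comp (fderiv ℝ τ x) = ContinuousLinearMap.id ℝ _ := by
    rw [← fderiv_comp x (hσ _) (hτ x), h.id, fderiv_id]
  have hm : jacobian σ (τ x) * jacobian τ x = 1 := by
    rw [jacobian_eq_toMatrix' (hσ _), jacobian_eq_toMatrix' (hτ x), ← LinearMap.toMatrix'_comp,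
      ← ContinuousLinearMap.toLinearMap_comp, hc, ContinuousLinearMap.coe_id, LinearMap.toMatrix'_id]
  have := congrArg Matrix.det hm
  rw [Matrix.det_mul, Matrix.det_one] at this
  exact right_ne_zero_of_mul_eq_one this

/-- The absolute value of a nowhere vanishing function of temperate growth has temperate
growth. -/
theorem Function.HasTemperateGrowth.abs {E : Type*} [NormedAddCommGroup E] [NormedSpace ℝ E]
    {f : E → ℝ} (hf : f.HasTemperateGrowth) (h0 : ∀ x, f x ≠ 0) :
    (fun x => |f x|).HasTemperateGrowth := by
  have hpc : IsPreconnected (Set.range f) := isPreconnected_range hf.1.continuous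
  by_cases hpos : ∃ x, 0 < f x
  · obtain ⟨x, hx⟩ := hpos
    have (y : E) : |f y| = f y := by
      refine abs_of_pos (lt_of_not_ge fun hy => ?_)
      obtain ⟨z, hz⟩ := hpc.Icc_subset ⟨y, rfl⟩ ⟨x, rfl⟩ ⟨hy, hx.le⟩
      exact h0 z hz
    simpa only [this] using hf
  · push Not at hpos
    simp only [fun x => abs_of_nonpos (hpos x)]
    exact hf.neg

/-- for a bounded diffeomorphism `σ` with inverse `τ`, the map
`ψ ↦ (ψ∘τ)·|det Jτ|` is a well-defined continuous linear operator on the Schwartz space. -/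
theorem statement12 {n : ℕ} (σ τ : (Fin n → ℝ) → (Fin n → ℝ))
    (h : IsBoundedDiffeo σ τ) :
    ∃ L : SchwartzMap (Fin n → ℝ) ℂ →L[ℂ] SchwartzMap (Fin n → ℝ) ℂ,
      ∀ (ψ : SchwartzMap (Fin n → ℝ) ℂ) (x : Fin n → ℝ),
        L ψ x = ψ (τ x) * ((|(jacobian τ x).det| : ℝ) : ℂ) := by
  obtain ⟨-, hστ, hσ, hτ, hbσ, hbτ⟩ := h
  have hσ' := contDiff_pi.1 hσ
  have hτ' := contDiff_pi.1 hτ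
  have tσ : σ.HasTemperateGrowth :=
    .pi fun j => hasTemperateGrowth_of_mderiv_of_one_le (hσ' j) (hbσ j)
  have tτ : τ.HasTemperateGrowth :=
    .pi fun j => hasTemperateGrowth_of_mderiv_of_one_le (hτ' j) (hbτ j)
  have hupper : ∃ (k : ℕ) (C : ℝ), ∀ x, ‖x‖ ≤ C * (1 + ‖τ x‖) ^ k := by
    obtain ⟨k, C, hC⟩ := tσ.2 0
    exact ⟨k, C, fun x => by simpa [hστ x] using hC (τ x)⟩
  have tdet : (fun x => |(jacobian τ x).det|).HasTemperateGrowth :=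
    Function.HasTemperateGrowth.abs
      (.matrix_det fun j k => hasTemperateGrowth_pd_of_mderiv (hτ' j) (hbτ j) k)
      (det_jacobian_ne_zero (hσ.differentiable (by simp)) (hτ.differentiable (by simp)) hστ)
  have tdetC : (fun x => ((|(jacobian τ x).det| : ℝ) : ℂ)).HasTemperateGrowth :=
    Function.HasTemperateGrowth.comp Function.Complex.hasTemperateGrowth_ofReal tdet
  refine ⟨(SchwartzMap.smulLeftCLM ℂ fun x => ((|(jacobian τ x).det| : ℝ) : ℂ)).comp
    (SchwartzMap.compCLM ℂ tτ hupper), fun ψ x => ?_⟩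
  simp [SchwartzMap.smulLeftCLM_apply_apply tdetC, mul_comm]
end
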